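/- Let m > 1 and r be integers with 0 < r < m/2, and fix c ∈ (0, π/2). There exist constants C > 0 and δ > 0 such that for every nonzero complex number z with |arg z| ≤ π/2 − c and |z| ≤ δ, setting x = e^{−z}, one has | Π_{j≥0} [ (1 − x^{mj+r})(1 − x^{mj+m−r}) ]^{−1} · 2 sin(πr/m) · e^{(m/12 + r²/(2m) − r/2) z − π²/(3mz)} − 1 | ≤ C · e^{−(4π²/m) · Re(1/z)}. -/

import Mathlib

open Complex Real

/-- `F(x) = Π_{j≥0} ((1 - x^{mj+r})(1 - x^{mj+m-r}))⁻¹` for `|x| < 1`. -/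
noncomputable def mixedProdInv (m r : ℕ) (x : ℂ) : ℂ :=
  ∏' j : ℕ, ((1 - x ^ (m * j + r)) * (1 - x ^ (m * j + (m - r))))⁻¹

/-- The `q`-Pochhammer symbol `(w; q)_∞ = ∏_{n ≥ 0} (1 - w qⁿ)`. -/
noncomputable def qPochhammer (q w : ℂ) : ℂ := ∏' n : ℕ, (1 - w * q ^ n)

lemma multipliable_qPochhammer {q : ℂ} (hq : ‖q‖ < 1) (w : ℂ) :
    Multipliable fun n : ℕ ↦ 1 - w * q ^ n := by
  simp_rw [sub_eq_add_neg]
  refine multipliable_one_add_of_summable ?_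
  simpa using (summable_geometric_of_lt_one (norm_nonneg q) hq).mul_left ‖w‖

lemma qPochhammer_eq_mul {q : ℂ} (hq : ‖q‖ < 1) (w : ℂ) :
    qPochhammer q w = (1 - w) * qPochhammer q (q * w) := by
  have hs (n : ℕ) : 1 - q * w * q ^ n = 1 - w * q ^ (n + 1) := by ring
  have h : Multipliable fun n : ℕ ↦ 1 - w * q ^ (n + 1) :=
    (multipliable_qPochhammer hq (q * w)).congr hs
  have h2 : qPochhammer q (q * w) = ∏' n : ℕ, (1 - w * q ^ (n + 1)) := tprod_congr hs
  have h3 := tprod_eq_zero_mul' (f := fun n : ℕ ↦ 1 - w * q ^ n) h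
  rw [h2, qPochhammer, h3, pow_zero, mul_one]

lemma differentiableOn_tprod_one_add {f : ℕ → ℂ → ℂ} {U : Set ℂ} (hU : IsOpen U)
    (hf : ∀ n, DifferentiableOn ℂ (f n) U)
    (hb : ∀ K ⊆ U, IsCompact K → ∃ u : ℕ → ℝ, Summable u ∧ ∀ n, ∀ x ∈ K, ‖f n x‖ ≤ u n) :
    DifferentiableOn ℂ (fun x ↦ ∏' n, (1 + f n x)) U := by
  have h : HasProdLocallyUniformlyOn (fun n x ↦ 1 + f n x) (fun x ↦ ∏' n, (1 + f n x)) U := by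
    refine hasProdLocallyUniformlyOn_of_forall_compact hU fun K hK hcK ↦ ?_
    obtain ⟨u, hu, hfu⟩ := hb K hK hcK
    exact hu.hasProdUniformlyOn_nat_one_add hcK (.of_forall hfu)
      fun n ↦ (hf n).continuousOn.mono hK
  refine TendstoLocallyUniformlyOn.differentiableOn h (.of_forall fun s ↦ ?_) hU
  simpa [Finset.prod_fn] using
    DifferentiableOn.finsetProd (fun n _ ↦ (differentiableOn_const 1).fun_add (hf n))

lemma differentiable_qPochhammer {q : ℂ} (hq : ‖q‖ < 1) : Differentiable ℂ (qPochhammer q) := by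
  rw [← differentiableOn_univ]
  unfold qPochhammer
  have := differentiableOn_tprod_one_add (f := fun n w ↦ -(w * q ^ n)) isOpen_univ
    (fun n ↦ by fun_prop) (fun K _ hK ↦ ?_)
  · simpa only [← sub_eq_add_neg] using this
  obtain ⟨B, hB⟩ := hK.isBounded.exists_norm_le
  refine ⟨fun n ↦ B * ‖q‖ ^ n, (summable_geometric_of_lt_one (norm_nonneg q) hq).mul_left B,
    fun n x hx ↦ ?_⟩
  simpa using mul_le_mul_of_nonneg_right (hB x hx) (by positivity)

lemma differentiableAt_qPochhammer_mul_self (a : ℂ) :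
    DifferentiableAt ℂ (fun q ↦ qPochhammer q (q * a)) 0 := by
  have := differentiableOn_tprod_one_add (f := fun n q ↦ -(q * a * q ^ n))
    (Metric.isOpen_ball (x := (0 : ℂ)) (ε := 1 / 2)) (fun n ↦ by fun_prop) (fun K hK _ ↦ ?_)
  · simp only [← sub_eq_add_neg] at this
    exact this.differentiableAt (Metric.ball_mem_nhds 0 (by norm_num))
  refine ⟨fun n ↦ ‖a‖ * (1 / 2) ^ n,
    (summable_geometric_of_lt_one (by norm_num) (by norm_num)).mul_left _, fun n x hx ↦ ?_⟩
  have hx' : ‖x‖ < 1 / 2 := by simpa using hK hx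
  have h1 : ‖x‖ ^ n ≤ (1 / 2) ^ n := by gcongr
  calc ‖-(x * a * x ^ n)‖ = ‖x‖ * (‖a‖ * ‖x‖ ^ n) := by simp [mul_assoc]
    _ ≤ 1 * (‖a‖ * (1 / 2) ^ n) := by gcongr; linarith
    _ = _ := one_mul _

lemma qPochhammer_zero_right (q : ℂ) : qPochhammer q 0 = 1 := by
  simp [qPochhammer]

lemma qPochhammer_self_ne_zero {q : ℂ} (hq : ‖q‖ < 1) : qPochhammer q q ≠ 0 := by
  unfold qPochhammer
  have := tprod_one_add_ne_zero_of_summable (f := fun n : ℕ ↦ -(q * q ^ n)) (fun n h ↦ ?_) ?_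
  · simpa only [← sub_eq_add_neg] using this
  · have h1 : q ^ (n + 1) = 1 := by rw [pow_succ']; linear_combination -h
    have h2 : ‖q‖ ^ (n + 1) < 1 := pow_lt_one₀ (norm_nonneg q) hq (by simp)
    rw [← norm_pow, h1, norm_one] at h2
    exact lt_irrefl _ h2
  · simpa using (summable_geometric_of_lt_one (norm_nonneg q) hq).mul_left ‖q‖

/-- The Jacobi product `∏_{n ≥ 0} (1 - qⁿ w) (1 - qⁿ⁺¹ w⁻¹)` with `q = e^{2πiτ}` and
`w = e^{2πiu}`. -/
noncomputable def jacobiProd (τ u : ℂ) : ℂ :=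
  qPochhammer (cexp (2 * π * I * τ)) (cexp (2 * π * I * u)) *
    qPochhammer (cexp (2 * π * I * τ)) (cexp (2 * π * I * (τ - u)))

lemma norm_cexp_two_pi_I_lt_one {τ : ℂ} (hτ : 0 < τ.im) : ‖cexp (2 * π * I * τ)‖ < 1 :=
  UpperHalfPlane.norm_exp_two_pi_I_lt_one ⟨τ, hτ⟩

lemma differentiable_jacobiProd {τ : ℂ} (hτ : 0 < τ.im) : Differentiable ℂ (jacobiProd τ) := by
  have h := differentiable_qPochhammer (norm_cexp_two_pi_I_lt_one hτ)
  exact (h.fun_comp (by fun_prop)).fun_mul (h.fun_comp (by fun_prop))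

lemma jacobiProd_eq_mul {τ : ℂ} (hτ : 0 < τ.im) (u : ℂ) :
    jacobiProd τ u = (1 - cexp (2 * π * I * u)) *
      (qPochhammer (cexp (2 * π * I * τ)) (cexp (2 * π * I * τ) * cexp (2 * π * I * u)) *
      qPochhammer (cexp (2 * π * I * τ)) (cexp (2 * π * I * τ) * cexp (-(2 * π * I * u)))) := by
  rw [jacobiProd, qPochhammer_eq_mul (norm_cexp_two_pi_I_lt_one hτ), mul_assoc,
    mul_sub (2 * π * I), sub_eq_add_neg (2 * π * I * τ), Complex.exp_add]

lemma jacobiProd_add_one (τ u : ℂ) : jacobiProd τ (u + 1) = jacobiProd τ u := by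
  have h1 : cexp (2 * π * I * (u + 1)) = cexp (2 * π * I * u) := by
    rw [mul_add, mul_one, Complex.exp_periodic]
  have h2 : cexp (2 * π * I * (τ - (u + 1))) = cexp (2 * π * I * (τ - u)) := by
    rw [← sub_sub, mul_sub _ _ 1, mul_one, Complex.exp_periodic.sub_eq]
  rw [jacobiProd, h1, h2, jacobiProd]

lemma jacobiProd_add_self {τ : ℂ} (hτ : 0 < τ.im) (u : ℂ) :
    jacobiProd τ u = -cexp (2 * π * I * u) * jacobiProd τ (u + τ) := by
  have h1 : cexp (2 * π * I * u) * cexp (-(2 * π * I * u)) = 1 := by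
    rw [← Complex.exp_add]; simp
  have h2 : 2 * π * I * (τ - (u + τ)) = -(2 * π * I * u) := by ring
  rw [jacobiProd_eq_mul hτ, jacobiProd, h2,
    qPochhammer_eq_mul (norm_cexp_two_pi_I_lt_one hτ) (cexp (-(2 * π * I * u))), mul_add,
    add_comm (_ * u), Complex.exp_add]
  linear_combination (-(qPochhammer (cexp (2 * π * I * τ)) (cexp (2 * π * I * τ) * cexp (2 * π * I * u)) *
    qPochhammer (cexp (2 * π * I * τ)) (cexp (2 * π * I * τ) * cexp (-(2 * π * I * u))))) * h1

lemma hasDerivAt_jacobiProd_zero {τ : ℂ} (hτ : 0 < τ.im) :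
    HasDerivAt (jacobiProd τ) (-(2 * π * I) * qPochhammer (cexp (2 * π * I * τ))
      (cexp (2 * π * I * τ)) ^ 2) 0 := by
  have hd := differentiable_qPochhammer (norm_cexp_two_pi_I_lt_one hτ)
  have h1 : HasDerivAt (fun u : ℂ ↦ 1 - cexp (2 * π * I * u)) (-(2 * π * I)) 0 := by
    simpa using (((hasDerivAt_id (0 : ℂ)).const_mul (2 * π * I)).cexp).const_sub 1
  have h2 : DifferentiableAt ℂ (fun u : ℂ ↦
      qPochhammer (cexp (2 * π * I * τ)) (cexp (2 * π * I * τ) * cexp (2 * π * I * u)) *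
      qPochhammer (cexp (2 * π * I * τ)) (cexp (2 * π * I * τ) * cexp (-(2 * π * I * u)))) 0 :=
    ((hd.fun_comp (by fun_prop)).fun_mul (hd.fun_comp (by fun_prop))) 0
  rw [funext (jacobiProd_eq_mul hτ)]
  convert! h1.fun_mul h2.hasDerivAt using 1
  simp [sq]

lemma intervalIntegral_shift_of_periodic {g : ℂ → ℂ} (hg : Differentiable ℂ g)
    (hper : ∀ u, g (u + 1) = g u) (τ : ℂ) :
    ∫ x in (0 : ℝ)..1, g (x + τ) = ∫ x in (0 : ℝ)..1, g x := by
  have h := integral_boundary_rect_eq_zero_of_differentiableOn g 0 (1 + τ.im * I)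
    hg.differentiableOn
  have hv : ∀ y : ℝ, g (1 + y * I) = g (y * I) := fun y ↦ by rw [add_comm, hper]
  simp only [zero_re, zero_im, add_re, one_re, mul_re, ofReal_re, I_re, mul_zero, ofReal_im, I_im,
    mul_one, sub_self, add_zero, ofReal_zero, zero_mul, add_im, one_im, mul_im, zero_add,
    ofReal_one, hv, add_sub_cancel_right] at h
  have hper' : Function.Periodic (fun x : ℝ ↦ g (x + τ.im * I)) 1 := fun x ↦ by
    simpa [add_right_comm] using hper (x + τ.im * I)
  have h2 := hper'.intervalIntegral_add_eq τ.re 0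
  rw [zero_add, ← sub_eq_zero.mp h] at h2
  have h3 := intervalIntegral.integral_comp_add_right (a := 0) (b := 1)
    (fun x : ℝ ↦ g (x + τ.im * I)) τ.re
  rw [zero_add, add_comm 1] at h3
  rw [← h2, ← h3]
  congr 1 with x
  rw [ofReal_add, add_assoc, re_add_im]

lemma eq_zero_of_quasiPeriodic {f : ℂ → ℂ} (hf : Differentiable ℂ f) {τ : ℂ}
    (h1 : ∀ u, f (u + 1) = f u) (hτ : ∀ u, f u = -cexp (2 * π * I * u) * f (u + τ))
    (h0 : ∫ x in (0 : ℝ)..1, f x = 0) : f = 0 := by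
  set g : ℤ → ℂ → ℂ := fun n u ↦ cexp (2 * π * I * (-n : ℤ) * u) * f u with hg
  have hgd : ∀ n, Differentiable ℂ (g n) := fun n ↦ by fun_prop
  have hg1 : ∀ n u, g n (u + 1) = g n u := fun n u ↦ by
    have : cexp (2 * π * I * (-n : ℤ)) = 1 := by
      rw [mul_comm, Complex.exp_int_mul_two_pi_mul_I]
    simp only [hg, h1, mul_add, mul_one, Complex.exp_add, this]
  have hrec : ∀ n, ∫ x in (0 : ℝ)..1, g (n + 1) x =
      -cexp (2 * π * I * n * τ) * ∫ x in (0 : ℝ)..1, g n x := fun n ↦ by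
    rw [← intervalIntegral_shift_of_periodic (hgd n) (hg1 n) τ,
      ← intervalIntegral.integral_const_mul]
    congr 1 with x
    simp only [hg]
    rw [hτ x, ← mul_assoc, ← mul_assoc, neg_mul, ← Complex.exp_add, mul_neg, ← Complex.exp_add]
    congr 3
    push_cast
    ring
  have hcoef : ∀ n, ∫ x in (0 : ℝ)..1, g n x = 0 := fun n ↦ by
    induction n using Int.induction_on with
    | zero => simpa [hg] using h0
    | succ i ih => rw [hrec, ih, mul_zero]
    | pred i ih =>
      have := hrec (-i - 1)
      rw [sub_add_cancel, ih] at this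
      simpa using this
  have hp : Function.Periodic (fun x : ℝ ↦ f x) 1 := fun x ↦ by simpa using h1 x
  have : Fact ((0 : ℝ) < 1) := ⟨one_pos⟩
  let F : C(AddCircle (1 : ℝ), ℂ) := ⟨hp.lift, by
    refine continuous_coinduced_dom.mpr ?_
    exact hf.continuous.comp continuous_ofReal⟩
  have hF : ∀ n, fourierCoeff F n = 0 := fun n ↦ by
    rw [fourierCoeff_eq_intervalIntegral _ _ 0, zero_add]
    simp only [fourier_coe_apply]
    convert smul_zero _
    refine Eq.trans ?_ (hcoef n)
    congr 1 with x
    simp [F, hg]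
  have hreal : ∀ x : ℝ, f x = 0 := fun x ↦ by
    have h := has_pointwise_sum_fourier_series_of_summable (f := F)
      (by simpa only [hF, funext hF] using summable_zero) (x : AddCircle (1 : ℝ))
    simp only [hF, zero_smul] at h
    exact h.unique hasSum_zero
  refine AnalyticOnNhd.eq_of_frequently_eq (z₀ := 0)
    (hf.differentiableOn.analyticOnNhd isOpen_univ) analyticOnNhd_const ?_
  have hlim : Filter.Tendsto (fun x : ℝ ↦ (x : ℂ)) (nhdsWithin 0 {0}ᶜ) (nhdsWithin 0 {0}ᶜ) :=
    tendsto_nhdsWithin_iff.2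
      ⟨(continuous_ofReal.tendsto' 0 0 ofReal_zero).mono_left nhdsWithin_le_nhds, by
        filter_upwards [self_mem_nhdsWithin] with x hx using by simpa using hx⟩
  exact hlim.frequently (Filter.Frequently.of_forall hreal)

/-- The right-hand side of the transformation formula of the Jacobi product under `τ ↦ -1/τ`. -/
noncomputable def jacobiProdDual (τ u : ℂ) : ℂ :=
  cexp (π * I * (u - u / τ - u ^ 2 / τ)) * jacobiProd (-1 / τ) (u / τ)

lemma im_neg_one_div_pos {τ : ℂ} (hτ : 0 < τ.im) : 0 < (-1 / τ).im := by
  have h := UpperHalfPlane.im_inv_neg_coe_pos ⟨τ, hτ⟩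
  rwa [inv_neg, ← one_div, ← neg_div] at h

lemma differentiable_jacobiProdDual {τ : ℂ} (hτ : 0 < τ.im) :
    Differentiable ℂ (jacobiProdDual τ) := by
  have h := differentiable_jacobiProd (im_neg_one_div_pos hτ)
  have h' : Differentiable ℂ fun u : ℂ ↦ jacobiProd (-1 / τ) (u / τ) := h.fun_comp (by fun_prop)
  unfold jacobiProdDual
  fun_prop

lemma jacobiProdDual_add_one {τ : ℂ} (hτ : 0 < τ.im) (u : ℂ) :
    jacobiProdDual τ (u + 1) = jacobiProdDual τ u := by
  have h0 : τ ≠ 0 := fun h ↦ by simp [h] at hτ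
  have h := jacobiProd_add_self (im_neg_one_div_pos hτ) ((u + 1) / τ)
  have h1 : (u + 1) / τ + -1 / τ = u / τ := by ring
  rw [h1] at h
  have h2 : cexp (π * I * (u + 1 - (u + 1) / τ - (u + 1) ^ 2 / τ)) *
      cexp (2 * π * I * ((u + 1) / τ)) = -cexp (π * I * (u - u / τ - u ^ 2 / τ)) := by
    rw [← Complex.exp_add, ← Complex.exp_add_pi_mul_I]
    congr 1
    ring
  rw [jacobiProdDual, h, jacobiProdDual]
  linear_combination (-jacobiProd (-1 / τ) (u / τ)) * h2

lemma jacobiProdDual_add_self {τ : ℂ} (hτ : 0 < τ.im) (u : ℂ) :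
    jacobiProdDual τ u = -cexp (2 * π * I * u) * jacobiProdDual τ (u + τ) := by
  have h0 : τ ≠ 0 := fun h ↦ by simp [h] at hτ
  have h1 : (u + τ) / τ = u / τ + 1 := by field_simp
  have h2 : cexp (2 * π * I * u) * cexp (π * I * (u + τ - (u + τ) / τ - (u + τ) ^ 2 / τ)) =
      -cexp (π * I * (u - u / τ - u ^ 2 / τ)) := by
    rw [← Complex.exp_add, ← Complex.exp_sub_pi_mul_I]
    congr 1
    field_simp
    ring
  rw [jacobiProdDual, jacobiProdDual, h1, jacobiProd_add_one]
  rw [h1] at h2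
  linear_combination jacobiProd (-1 / τ) (u / τ) * h2

lemma hasDerivAt_jacobiProdDual_zero {τ : ℂ} (hτ : 0 < τ.im) :
    HasDerivAt (jacobiProdDual τ) (-(2 * π * I) * qPochhammer (cexp (2 * π * I * (-1 / τ)))
      (cexp (2 * π * I * (-1 / τ))) ^ 2 / τ) 0 := by
  have h1 : HasDerivAt (fun u : ℂ ↦ jacobiProd (-1 / τ) (u / τ))
      (-(2 * π * I) * qPochhammer (cexp (2 * π * I * (-1 / τ)))
        (cexp (2 * π * I * (-1 / τ))) ^ 2 * (1 / τ)) 0 := by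
    have h := hasDerivAt_jacobiProd_zero (im_neg_one_div_pos hτ)
    refine HasDerivAt.comp (0 : ℂ) (h₂ := jacobiProd (-1 / τ)) (h := fun u ↦ u / τ) ?_
      ((hasDerivAt_id (0 : ℂ)).div_const τ)
    simpa using h
  have h2 : DifferentiableAt ℂ (fun u : ℂ ↦ cexp (π * I * (u - u / τ - u ^ 2 / τ))) 0 := by
    fun_prop
  have h3 : jacobiProd (-1 / τ) 0 = 0 := by
    rw [jacobiProd_eq_mul (im_neg_one_div_pos hτ)]
    simp
  unfold jacobiProdDual
  convert! h2.hasDerivAt.fun_mul h1 using 1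
  simp only [zero_div, h3]
  simp [div_eq_mul_inv]

lemma qPochhammer_sq_mul_jacobiProd {τ : ℂ} (hτ : 0 < τ.im) (u : ℂ) :
    qPochhammer (cexp (2 * π * I * (-1 / τ))) (cexp (2 * π * I * (-1 / τ))) ^ 2 *
        jacobiProd τ u =
      τ * qPochhammer (cexp (2 * π * I * τ)) (cexp (2 * π * I * τ)) ^ 2 *
        jacobiProdDual τ u := by
  have h0 : τ ≠ 0 := fun h ↦ by simp [h] at hτ
  set A := qPochhammer (cexp (2 * π * I * τ)) (cexp (2 * π * I * τ)) with hA
  set B := qPochhammer (cexp (2 * π * I * (-1 / τ))) (cexp (2 * π * I * (-1 / τ)))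
  have hA0 : A ≠ 0 := qPochhammer_self_ne_zero (norm_cexp_two_pi_I_lt_one hτ)
  have hpi : (2 * π * I : ℂ) ≠ 0 := by simp [Real.pi_ne_zero]
  have hd := differentiable_jacobiProd hτ
  have hd' := differentiable_jacobiProdDual hτ
  set a := ∫ x in (0 : ℝ)..1, jacobiProd τ x
  set b := ∫ x in (0 : ℝ)..1, jacobiProdDual τ x
  have hi : IntervalIntegrable (fun x : ℝ ↦ jacobiProd τ x) MeasureTheory.volume 0 1 :=
    (hd.continuous.comp continuous_ofReal).intervalIntegrable _ _
  have hi' : IntervalIntegrable (fun x : ℝ ↦ jacobiProdDual τ x) MeasureTheory.volume 0 1 :=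
    (hd'.continuous.comp continuous_ofReal).intervalIntegrable _ _
  have hf : (fun u ↦ a * jacobiProdDual τ u - b * jacobiProd τ u) = 0 := by
    refine eq_zero_of_quasiPeriodic (τ := τ) (by fun_prop) (fun u ↦ ?_) (fun u ↦ ?_) ?_
    · simp only [jacobiProdDual_add_one hτ, jacobiProd_add_one]
    · simp only [jacobiProdDual_add_self hτ u, jacobiProd_add_self hτ u]
      ring
    · rw [intervalIntegral.integral_sub (hi'.const_mul a) (hi.const_mul b),
        intervalIntegral.integral_const_mul, intervalIntegral.integral_const_mul]
      ring
  have hder : a * B ^ 2 = b * (τ * A ^ 2) := by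
    have h := ((hasDerivAt_jacobiProdDual_zero hτ).const_mul a).fun_sub
      ((hasDerivAt_jacobiProd_zero hτ).const_mul b)
    rw [hf] at h
    have h' : a * (-(2 * π * I) * B ^ 2 / τ) - b * (-(2 * π * I) * A ^ 2) = 0 :=
      h.unique (hasDerivAt_const (0 : ℂ) (0 : ℂ))
    have h'' : a * B ^ 2 / τ = b * A ^ 2 := mul_left_cancel₀ hpi (by linear_combination -h')
    rw [div_eq_iff h0] at h''
    linear_combination h''
  have ha : a ≠ 0 := fun ha ↦ by
    have hz : jacobiProd τ = 0 := eq_zero_of_quasiPeriodic (τ := τ) hd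
      (jacobiProd_add_one τ) (jacobiProd_add_self hτ) ha
    have h := hasDerivAt_jacobiProd_zero hτ
    rw [hz] at h
    have := h.unique (hasDerivAt_const (0 : ℂ) (0 : ℂ))
    simp [← hA, hA0, Real.pi_ne_zero] at this
  have hfu : a * jacobiProdDual τ u - b * jacobiProd τ u = 0 := congrFun hf u
  refine mul_left_cancel₀ ha ?_
  linear_combination jacobiProd τ u * hder - τ * A ^ 2 * hfu

lemma eta_sq_neg_one_div {τ : ℂ} (hτ : 0 < τ.im) :
    ModularForm.eta (-1 / τ) ^ 2 = -I * τ * ModularForm.eta τ ^ 2 := by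
  have h : ModularForm.eta (-1 / τ) = _ := ModularForm.eta_comp_eq_csqrt_I_inv hτ
  have hsq (z : ℂ) : Complex.sqrt z ^ 2 = z := by
    simp [Complex.sqrt]
  rw [h]
  simp only [Pi.smul_apply, Pi.mul_apply, smul_eq_mul, mul_pow, inv_pow, hsq, inv_I]
  ring

lemma eta_sq_eq (τ : ℂ) : ModularForm.eta τ ^ 2 = cexp (π * I * τ / 6) *
    qPochhammer (cexp (2 * π * I * τ)) (cexp (2 * π * I * τ)) ^ 2 := by
  rw [ModularForm.eta, mul_pow, Function.Periodic.qParam, ← Complex.exp_nat_mul]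
  congr 2
  · push_cast; ring_nf
  · exact tprod_congr fun n ↦ by rw [ModularForm.eta_q_eq_pow, pow_succ']

lemma jacobiProd_eq_dual {τ : ℂ} (hτ : 0 < τ.im) (u : ℂ) :
    cexp (π * I * τ / 6) * jacobiProd τ u =
      I * cexp (π * I * (-1 / τ) / 6) * jacobiProdDual τ u := by
  have h0 : τ ≠ 0 := fun h ↦ by simp [h] at hτ
  have hA0 := qPochhammer_self_ne_zero (norm_cexp_two_pi_I_lt_one hτ)
  have h1 := qPochhammer_sq_mul_jacobiProd hτ u
  have h2 := eta_sq_neg_one_div hτ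
  rw [eta_sq_eq, eta_sq_eq] at h2
  refine mul_left_cancel₀ (mul_ne_zero h0 (pow_ne_zero 2 hA0)) ?_
  linear_combination (I * cexp (π * I * (-1 / τ) / 6)) * h1 - I * jacobiProd τ u * h2 +
    (τ * cexp (π * I * τ / 6) * jacobiProd τ u *
      qPochhammer (cexp (2 * π * I * τ)) (cexp (2 * π * I * τ)) ^ 2) * I_sq

lemma mixedProdInv_eq_inv_jacobiProd {m r : ℕ} (hm : m ≠ 0) (hrm : r ≤ m) {z τ : ℂ}
    (hτ : 0 < τ.im) (hz : 2 * π * I * τ = -(m * z)) (h0 : jacobiProd τ (r * τ / m) ≠ 0) :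
    mixedProdInv m r (cexp (-z)) = (jacobiProd τ (r * τ / m))⁻¹ := by
  have hm' : (m : ℂ) ≠ 0 := Nat.cast_ne_zero.mpr hm
  have hq : cexp (2 * π * I * τ) = cexp (-z) ^ m := by
    rw [hz, ← Complex.exp_nat_mul]
    congr 1
    ring
  have hw : cexp (2 * π * I * (r * τ / m)) = cexp (-z) ^ r := by
    rw [← Complex.exp_nat_mul]
    congr 1
    field_simp
    linear_combination r * hz
  have hw' : cexp (2 * π * I * (τ - r * τ / m)) = cexp (-z) ^ (m - r) := by
    rw [← Complex.exp_nat_mul, Nat.cast_sub hrm]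
    congr 1
    field_simp
    linear_combination (m - r : ℂ) * hz
  have hlt := norm_cexp_two_pi_I_lt_one hτ
  have hM := (multipliable_qPochhammer hlt (cexp (-z) ^ r)).mul
    (multipliable_qPochhammer hlt (cexp (-z) ^ (m - r)))
  have hP : jacobiProd τ (r * τ / m) = ∏' n : ℕ, ((1 - cexp (-z) ^ r * cexp (2 * π * I * τ) ^ n) *
      (1 - cexp (-z) ^ (m - r) * cexp (2 * π * I * τ) ^ n)) := by
    rw [jacobiProd, hw, hw', (multipliable_qPochhammer hlt _).tprod_mul
      (multipliable_qPochhammer hlt _)]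
    rfl
  rw [hP] at h0 ⊢
  rw [← hM.tprod_inv₀ h0, mixedProdInv]
  refine tprod_congr fun n ↦ ?_
  rw [hq, ← pow_mul, ← pow_add, ← pow_add, add_comm r, add_comm (m - r)]

/-- The transformation formula of the Jacobi product along `u = ρτ`. -/
lemma jacobiProd_mul_eq {τ : ℂ} (hτ : 0 < τ.im) (ρ : ℝ) :
    jacobiProd τ (ρ * τ) = 2 * Real.sin (π * ρ) *
      cexp (π * I * (ρ * τ - ρ ^ 2 * τ - τ / 6 - 1 / (6 * τ))) *
      (qPochhammer (cexp (2 * π * I * (-1 / τ)))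
          (cexp (2 * π * I * (-1 / τ)) * cexp (2 * π * I * ρ)) *
        qPochhammer (cexp (2 * π * I * (-1 / τ)))
          (cexp (2 * π * I * (-1 / τ)) * cexp (-(2 * π * I * ρ)))) := by
  have h0 : τ ≠ 0 := fun h ↦ by simp [h] at hτ
  have h := jacobiProd_eq_dual hτ (ρ * τ)
  have h1 : ρ * τ / τ = ρ := by field_simp
  rw [jacobiProdDual, h1, jacobiProd_eq_mul (im_neg_one_div_pos hτ)] at h
  set H := qPochhammer (cexp (2 * π * I * (-1 / τ)))
          (cexp (2 * π * I * (-1 / τ)) * cexp (2 * π * I * ρ)) *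
        qPochhammer (cexp (2 * π * I * (-1 / τ)))
          (cexp (2 * π * I * (-1 / τ)) * cexp (-(2 * π * I * ρ)))
  have hsin : I * (1 - cexp (2 * π * I * ρ)) = 2 * Real.sin (π * ρ) * cexp (π * I * ρ) := by
    rw [ofReal_sin, Complex.sin]
    have e1 : cexp (2 * π * I * ρ) = cexp (π * I * ρ) * cexp (π * I * ρ) := by
      rw [← Complex.exp_add]; ring_nf
    have e2 : cexp (-(π * I * ρ)) * cexp (π * I * ρ) = 1 := by
      rw [← Complex.exp_add]; simp
    have e3 : (-((π * ρ : ℝ) : ℂ)) * I = -(π * I * ρ) := by push_cast; ring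
    have e4 : ((π * ρ : ℝ) : ℂ) * I = π * I * ρ := by push_cast; ring
    rw [e3, e4, e1]
    linear_combination (-I) * e2
  have hexp : cexp (π * I * ρ) * (cexp (π * I * (-1 / τ) / 6) *
      cexp (π * I * (ρ * τ - ρ - (ρ * τ) ^ 2 / τ))) =
      cexp (π * I * τ / 6) * cexp (π * I * (ρ * τ - ρ ^ 2 * τ - τ / 6 - 1 / (6 * τ))) := by
    simp only [← Complex.exp_add]
    congr 1
    field_simp
    ring
  refine mul_left_cancel₀ (Complex.exp_ne_zero (π * I * τ / 6)) ?_
  linear_combination h + cexp (π * I * (-1 / τ) / 6) *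
      cexp (π * I * (ρ * τ - ρ - (ρ * τ) ^ 2 / τ)) * H * hsin +
    2 * Real.sin (π * ρ) * H * hexp

lemma exists_norm_inv_qPochhammer_sub_one_le (a b : ℂ) :
    ∃ C > (0 : ℝ), ∃ ε > (0 : ℝ), ∀ q : ℂ, ‖q‖ < ε →
      qPochhammer q (q * a) * qPochhammer q (q * b) ≠ 0 ∧
      ‖(qPochhammer q (q * a) * qPochhammer q (q * b))⁻¹ - 1‖ ≤ C * ‖q‖ := by
  set H : ℂ → ℂ := fun q ↦ qPochhammer q (q * a) * qPochhammer q (q * b) with hH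
  have hd : DifferentiableAt ℂ H 0 := (differentiableAt_qPochhammer_mul_self a).fun_mul
    (differentiableAt_qPochhammer_mul_self b)
  have h1 : H 0 = 1 := by simp [hH, qPochhammer_zero_right]
  have hne : ∀ᶠ q in nhds 0, H q ≠ 0 := hd.continuousAt.eventually_ne (by simp [h1])
  obtain ⟨C, hC, hO⟩ := (hd.fun_inv (by simp [h1])).isBigO_sub.exists_pos
  obtain ⟨ε, hε, h⟩ := Metric.eventually_nhds_iff.mp (hne.and hO.bound)
  refine ⟨C, hC, ε, hε, fun q hq ↦ ?_⟩
  have hb := h (y := q) (by simpa using hq)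
  rwa [h1, inv_one, sub_zero] at hb

lemma sin_div_norm_le_re_one_div {c : ℝ} (hc : 0 ≤ c) {z : ℂ} (hz : z ≠ 0)
    (harg : |z.arg| ≤ π / 2 - c) : Real.sin c / ‖z‖ ≤ (1 / z).re := by
  have hn : 0 < ‖z‖ := norm_pos_iff.mpr hz
  have hcos : Real.sin c ≤ Real.cos z.arg := by
    rw [← Real.cos_abs z.arg, ← Real.cos_pi_div_two_sub]
    exact Real.cos_le_cos_of_nonneg_of_le_pi (abs_nonneg _) (by linarith [Real.pi_pos]) harg
  rw [one_div, inv_re, ← norm_mul_cos_arg, normSq_eq_norm_sq, div_le_div_iff₀ hn (by positivity)]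
  nlinarith [mul_le_mul_of_nonneg_right hcos (sq_nonneg ‖z‖)]

/-- Quantitative modular-type asymptotic for `F(e^{-z})` as `z → 0` in a sector:
`F(e^{-z}) · 2 sin(πr/m) · e^{(m/12 + r²/(2m) - r/2) z - π²/(3mz)} = 1 +
O(e^{-(4π²/m) Re(1/z)})`. -/
theorem stmt4 (m r : ℕ) (hm : 1 < m) (hr : 0 < r) (hrm : 2 * r < m)
    (c : ℝ) (hc : 0 < c) (hc' : c < π / 2) :
    ∃ C > (0 : ℝ), ∃ δ > (0 : ℝ), ∀ z : ℂ, z ≠ 0 → |z.arg| ≤ π / 2 - c →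
      ‖z‖ ≤ δ →
      ‖mixedProdInv m r (Complex.exp (-z)) * (2 * (Real.sin (π * r / m) : ℂ)) *
          Complex.exp (((m : ℂ) / 12 + (r : ℂ) ^ 2 / (2 * (m : ℂ)) - (r : ℂ) / 2) * z -
            (π : ℂ) ^ 2 / (3 * (m : ℂ) * z)) - 1‖ ≤
        C * Real.exp (-(4 * π ^ 2 / m) * (1 / z).re) := by
  have hm0 : (0 : ℝ) < m := by exact_mod_cast (zero_lt_one.trans hm)
  have hmc : (m : ℂ) ≠ 0 := by exact_mod_cast hm0.ne'
  have hpc : (π : ℂ) ≠ 0 := by exact_mod_cast Real.pi_ne_zero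
  obtain ⟨C, hC, ε, hε, hbound⟩ := exists_norm_inv_qPochhammer_sub_one_le
    (cexp (2 * π * I * (r / m : ℝ))) (cexp (-(2 * π * I * (r / m : ℝ))))
  have hsinc : 0 < Real.sin c := Real.sin_pos_of_pos_of_lt_pi hc (by linarith)
  set K := 4 * π ^ 2 / m * Real.sin c with hK
  have hKpos : 0 < K := by positivity
  refine ⟨C, hC, K * ε, by positivity, fun z hz harg hzδ ↦ ?_⟩
  have hn : 0 < ‖z‖ := norm_pos_iff.mpr hz
  have hre := sin_div_norm_le_re_one_div hc.le hz harg
  have hzre : 0 < z.re := by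
    have h : 0 < (1 / z).re := lt_of_lt_of_le (by positivity) hre
    rw [one_div, inv_re] at h
    exact (div_pos_iff_of_pos_right (normSq_pos.mpr hz)).mp h
  set τ : ℂ := m * z * I / (2 * π) with hτdef
  have hτ : 0 < τ.im := by
    have : τ = ((m / (2 * π) : ℝ) : ℂ) * (z * I) := by
      rw [hτdef]; push_cast; ring
    rw [this, im_ofReal_mul, mul_I_im]
    positivity
  have hτz : 2 * π * I * τ = -(m * z) := by
    rw [hτdef]
    field_simp
    simp
  have hτinv : 2 * π * I * (-1 / τ) = ((-(4 * π ^ 2 / m) : ℝ) : ℂ) * (1 / z) := by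
    rw [hτdef]
    push_cast
    field_simp
    norm_num
  have hq : ‖cexp (2 * π * I * (-1 / τ))‖ = Real.exp (-(4 * π ^ 2 / m) * (1 / z).re) := by
    rw [hτinv, Complex.norm_exp, re_ofReal_mul]
  have hqε : ‖cexp (2 * π * I * (-1 / τ))‖ < ε := by
    have h1 : 1 / ε ≤ 4 * π ^ 2 / m * (1 / z).re := calc
      1 / ε ≤ K / ‖z‖ := by rw [div_le_div_iff₀ hε hn]; linarith
      _ = 4 * π ^ 2 / m * (Real.sin c / ‖z‖) := by rw [hK]; ring
      _ ≤ _ := by gcongr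
    have h2 : 1 / ε < Real.exp (1 / ε) := by linarith [Real.add_one_le_exp (1 / ε)]
    calc ‖cexp (2 * π * I * (-1 / τ))‖ ≤ Real.exp (-(1 / ε)) := by
          rw [hq, Real.exp_le_exp]; linarith
      _ < ε := by rw [Real.exp_neg]; exact inv_lt_of_inv_lt₀ hε (by rwa [← one_div])
  obtain ⟨hH0, hH⟩ := hbound _ hqε
  have hP := jacobiProd_mul_eq hτ (r / m : ℝ)
  set H := qPochhammer (cexp (2 * π * I * (-1 / τ)))
      (cexp (2 * π * I * (-1 / τ)) * cexp (2 * π * I * (r / m : ℝ))) *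
    qPochhammer (cexp (2 * π * I * (-1 / τ)))
      (cexp (2 * π * I * (-1 / τ)) * cexp (-(2 * π * I * (r / m : ℝ))))
  have hexp : π * I * ((r / m : ℝ) * τ - (r / m : ℝ) ^ 2 * τ - τ / 6 - 1 / (6 * τ)) =
      ((m : ℂ) / 12 + (r : ℂ) ^ 2 / (2 * (m : ℂ)) - (r : ℂ) / 2) * z -
        (π : ℂ) ^ 2 / (3 * (m : ℂ) * z) := by
    have h1 : π * I * (1 / τ) = 2 * π ^ 2 / (m * z) := by
      rw [hτdef]
      field_simp
    push_cast
    calc _ = (r / m - (r / m) ^ 2 - 1 / 6) * (2 * π * I * τ) / 2 - π * I * (1 / τ) / 6 := by ring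
      _ = _ := by
        rw [hτz, h1]
        field_simp
        ring
  have hu : ((r / m : ℝ) : ℂ) * τ = r * τ / m := by push_cast; ring
  have hs : π * (r / m : ℝ) = π * r / m := by ring
  rw [hexp, hu, hs] at hP
  set E := cexp (((m : ℂ) / 12 + (r : ℂ) ^ 2 / (2 * (m : ℂ)) - (r : ℂ) / 2) * z -
        (π : ℂ) ^ 2 / (3 * (m : ℂ) * z)) with hE
  have hE0 : E ≠ 0 := Complex.exp_ne_zero _
  have hS0 : (Real.sin (π * r / m) : ℂ) ≠ 0 := by
    have hr' : (0 : ℝ) < r := by exact_mod_cast hr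
    have hrm' : (r : ℝ) < m := by exact_mod_cast (by omega : r < m)
    refine ofReal_ne_zero.mpr (Real.sin_pos_of_pos_of_lt_pi (by positivity) ?_).ne'
    rw [div_lt_iff₀ hm0]
    gcongr
  have hJ0 : jacobiProd τ (r * τ / m) ≠ 0 := by
    rw [hP]
    exact mul_ne_zero (mul_ne_zero (mul_ne_zero two_ne_zero hS0) hE0) hH0
  rw [mixedProdInv_eq_inv_jacobiProd (by omega) (by omega) hτ hτz hJ0, hP, ← hq]
  convert hH using 3
  field_simp
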